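/- Let d ≥ 2, n ≥ 1 and let α be an integer with max{d, n} ≤ α ≤ dn. Then U(α, d, n) is the maximum of C_D over the set of matrices X ∈ 𝔹^{d×n}_{≠0} with ‖X‖₀ = α; that is: (a) every X ∈ 𝔹^{d×n}_{≠0} with ‖X‖₀ = α satisfies C_D(X) ≤ U(α, d, n), and (b) there exists X ∈ 𝔹^{d×n}_{≠0} with ‖X‖₀ = α and C_D(X) = U(α, d, n). -/

import Mathlib

open scoped BigOperators

/-- Number of nonzero entries of row `i` of `X`. -/
noncomputable def nnzRow {d n : ℕ} (X : Matrix (Fin d) (Fin n) ℝ) (i : Fin d) : ℕ :=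
  (Finset.univ.filter fun j => X i j ≠ 0).card

/-- Number of nonzero entries of column `j` of `X`. -/
noncomputable def nnzCol {d n : ℕ} (X : Matrix (Fin d) (Fin n) ℝ) (j : Fin n) : ℕ :=
  (Finset.univ.filter fun i => X i j ≠ 0).card

/-- Total number of nonzero entries of `X`. -/
noncomputable def nnz {d n : ℕ} (X : Matrix (Fin d) (Fin n) ℝ) : ℕ :=
  ∑ i, nnzRow X i

/-- `X` has all its entries in `{−1, 0, 1}`. -/
def IsBinary {d n : ℕ} (X : Matrix (Fin d) (Fin n) ℝ) : Prop :=
  ∀ i j, X i j = -1 ∨ X i j = 0 ∨ X i j = 1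

/-- `X` has no zero row and no zero column. -/
def NoZeroRowCol {d n : ℕ} (X : Matrix (Fin d) (Fin n) ℝ) : Prop :=
  (∀ i, ∃ j, X i j ≠ 0) ∧ (∀ j, ∃ i, X i j ≠ 0)

/-- For binary matrices, `C_P(X) = ∑ᵢ ‖X₍i:₎‖₀²`. -/
noncomputable def CP {d n : ℕ} (X : Matrix (Fin d) (Fin n) ℝ) : ℕ :=
  ∑ i, nnzRow X i ^ 2

/-- For binary matrices, `C_D(X) = ∑ⱼ ‖X₍:j₎‖₀²`. -/
noncomputable def CD {d n : ℕ} (X : Matrix (Fin d) (Fin n) ℝ) : ℕ :=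
  ∑ j, nnzCol X j ^ 2

/-- `ā_b = b⌊a/b⌋`: `a` rounded down to the closest multiple of `b`. -/
def rnd (a b : ℕ) : ℕ := b * (a / b)

/-- `L(α, n) = (1/n)(ᾱ_n² + (α − ᾱ_n)(2ᾱ_n + n))`. -/
noncomputable def Lfun (α n : ℕ) : ℝ :=
  (1 / (n : ℝ)) * ((rnd α n : ℝ) ^ 2 +
    ((α - rnd α n : ℕ) : ℝ) * (2 * (rnd α n : ℝ) + (n : ℝ)))

/-- `U(α, d, n) = (d+1)·(α−n)̄_{d−1} + n − 1 + (α − n + 1 − (α−n)̄_{d−1})²`. -/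
noncomputable def Ufun (α d n : ℕ) : ℝ :=
  ((d : ℝ) + 1) * (rnd (α - n) (d - 1) : ℝ) + (n : ℝ) - 1 +
    ((α - n + 1 - rnd (α - n) (d - 1) : ℕ) : ℝ) ^ 2

lemma aux_step (m s x : ℕ) (hm : 1 ≤ m) (hx : x ≤ m) :
    x ^ 2 + ((s / m) * m ^ 2 + (s % m) ^ 2) ≤ ((s + x) / m) * m ^ 2 + ((s + x) % m) ^ 2 := by
  have hs := Nat.div_add_mod s m
  have hr : s % m < m := Nat.mod_lt _ (by omega)
  generalize s / m = q at *
  generalize s % m = r at *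
  subst hs
  by_cases h : r + x < m
  · have h1 : (m * q + r + x) / m = q := by
      rw [add_assoc, Nat.mul_add_div (by omega), Nat.div_eq_of_lt h, add_zero]
    have h2 : (m * q + r + x) % m = r + x := by
      rw [add_assoc, Nat.mul_add_mod, Nat.mod_eq_of_lt h]
    rw [h1, h2]
    nlinarith [Nat.zero_le (r * x)]
  · obtain ⟨t, ht⟩ := Nat.exists_eq_add_of_le (not_lt.mp h)
    have htm : t < m := by omega
    have h0 : m * q + r + x = m * (q + 1) + t := by rw [mul_add]; omega
    have h1 : (m * q + r + x) / m = q + 1 := by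
      rw [h0, Nat.mul_add_div (by omega), Nat.div_eq_of_lt htm, add_zero]
    have h2 : (m * q + r + x) % m = t := by
      rw [h0, Nat.mul_add_mod, Nat.mod_eq_of_lt htm]
    rw [h1, h2]
    obtain ⟨a, rfl⟩ := Nat.exists_eq_add_of_le hx
    obtain rfl : r = a + t := by omega
    obtain ⟨b, hb⟩ := Nat.exists_eq_add_of_lt hr
    obtain rfl : x = t + b + 1 := by omega
    nlinarith [Nat.zero_le (a * b)]

lemma aux_sum {ι : Type*} (S : Finset ι) (f : ι → ℕ) (m : ℕ) (hm : 1 ≤ m)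
    (hf : ∀ i, f i ≤ m) :
    ∑ i ∈ S, f i ^ 2 ≤ ((∑ i ∈ S, f i) / m) * m ^ 2 + ((∑ i ∈ S, f i) % m) ^ 2 := by
  classical
  induction S using Finset.induction_on with
  | empty => simp
  | insert a S ha ih =>
    rw [Finset.sum_insert ha, Finset.sum_insert ha]
    have := aux_step m (∑ i ∈ S, f i) (f a) hm (hf a)
    rw [add_comm (f a)]
    omega

lemma nnz_eq_col {d n : ℕ} (X : Matrix (Fin d) (Fin n) ℝ) : nnz X = ∑ j, nnzCol X j := by
  unfold nnz nnzRow nnzCol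
  simp only [Finset.card_filter]
  exact Finset.sum_comm

lemma Ufun_eq (α d n : ℕ) (hd : 2 ≤ d) (hα : n ≤ α) :
    Ufun α d n = (((((α - n) / (d - 1)) * (d - 1) ^ 2 + ((α - n) % (d - 1)) ^ 2)
      + 2 * (α - n) + n : ℕ) : ℝ) := by
  obtain ⟨s, rfl⟩ := Nat.exists_eq_add_of_le hα
  obtain ⟨m, rfl⟩ := Nat.exists_eq_add_of_le hd
  have e1 : n + s - n = s := by omega
  have e2 : 2 + m - 1 = m + 1 := by omega
  unfold Ufun rnd
  rw [e1, e2]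
  have hs := Nat.div_add_mod s (m + 1)
  have e3 : s + 1 - (m + 1) * (s / (m + 1)) = s % (m + 1) + 1 := by omega
  rw [e3]
  generalize s / (m + 1) = q at *
  generalize s % (m + 1) = r at *
  subst hs
  push_cast
  ring

lemma sum_pattern (q k A B C : ℕ) :
    ∑ j ∈ Finset.range (q + 1 + k), (if j < q then A else if j = q then B else C)
      = q * A + B + k * C := by
  rw [Finset.sum_range_add, Finset.sum_range_succ]
  have h1 : ∑ j ∈ Finset.range q, (if j < q then A else if j = q then B else C) = q * A := by
    rw [Finset.sum_congr rfl (g := fun _ => A)]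
    · simp
    · intro j hj
      simp [Finset.mem_range.mp hj]
  have h2 : ∑ j ∈ Finset.range k, (if q + 1 + j < q then A else if q + 1 + j = q then B else C)
      = k * C := by
    rw [Finset.sum_congr rfl (g := fun _ => C)]
    · simp
    · intro j hj
      rw [if_neg (by omega), if_neg (by omega)]
  rw [h1, h2]
  simp

lemma upper (d n α : ℕ) (hd : 2 ≤ d) (hα : n ≤ α) (X : Matrix (Fin d) (Fin n) ℝ)
    (h : NoZeroRowCol X) (hX : nnz X = α) : (CD X : ℝ) ≤ Ufun α d n := by
  rw [Ufun_eq α d n hd hα]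
  norm_cast
  have hpos : ∀ j, 1 ≤ nnzCol X j := by
    intro j
    obtain ⟨i, hi⟩ := h.2 j
    exact Finset.card_pos.mpr ⟨i, by simp [hi]⟩
  have hle : ∀ j, nnzCol X j ≤ d := by
    intro j
    simpa [nnzCol] using Finset.card_filter_le (Finset.univ : Finset (Fin d)) fun i => X i j ≠ 0
  rw [nnz_eq_col] at hX
  have hc : ∀ j, nnzCol X j = (nnzCol X j - 1) + 1 := fun j => by have := hpos j; omega
  have hs : ∑ j, (nnzCol X j - 1) + n = α := by
    rw [← hX, Finset.sum_congr rfl fun j _ => hc j, Finset.sum_add_distrib]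
    simp
  have hs' : ∑ j, (nnzCol X j - 1) = α - n := by omega
  have key := aux_sum Finset.univ (fun j => nnzCol X j - 1) (d - 1) (by omega)
    (fun j => by have := hle j; omega)
  rw [hs'] at key
  have hcd : CD X = ∑ j, (nnzCol X j - 1) ^ 2 + 2 * (α - n) + n := by
    unfold CD
    rw [← hs', Finset.mul_sum, ← Finset.sum_add_distrib]
    have hone : ∑ j : Fin n, 1 = n := by simp
    refine Eq.trans ?_ (congrArg (fun t => ∑ j, ((nnzCol X j - 1) ^ 2 + 2 * (nnzCol X j - 1)) + t)
      hone)
    rw [← Finset.sum_add_distrib]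
    apply Finset.sum_congr rfl
    intro j _
    obtain ⟨c, hc⟩ := Nat.exists_eq_add_of_le (hpos j)
    rw [hc, Nat.add_sub_cancel_left]
    ring
  rw [hcd]
  omega

/-- Support pattern of the maximiser. -/
def pat (d q r i j : ℕ) : Prop :=
  j < q ∨ (j = q ∧ i ≤ r) ∨ (q < j ∧ i = min (r + (j - q)) (d - 1))

open Classical in
/-- The maximiser. -/
noncomputable def maxX (d n q r : ℕ) : Matrix (Fin d) (Fin n) ℝ :=
  fun i j => if pat d q r i j then 1 else 0

lemma maxX_ne {d n q r : ℕ} (i : Fin d) (j : Fin n) :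
    maxX d n q r i j ≠ 0 ↔ pat d q r i j := by
  unfold maxX
  split_ifs with h <;> simp [h]

lemma maxX_col {d n q r : ℕ} (hr : r < d) (j : Fin n) :
    nnzCol (maxX d n q r) j = if (j : ℕ) < q then d else if (j : ℕ) = q then r + 1 else 1 := by
  classical
  unfold nnzCol
  simp only [maxX_ne]
  split_ifs with h1 h2
  · have hp : ∀ i ∈ (Finset.univ : Finset (Fin d)), pat d q r i j := fun i _ => Or.inl h1
    rw [Finset.filter_true_of_mem hp]
    simp
  · have : (Finset.univ.filter fun i : Fin d => pat d q r i j) = Finset.Iic ⟨r, hr⟩ := by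
      ext i
      simp only [Finset.mem_filter, Finset.mem_univ, true_and, Finset.mem_Iic, Fin.le_def]
      unfold pat
      omega
    rw [this, Fin.card_Iic]
  · rw [Finset.card_eq_one]
    refine ⟨⟨min (r + (j - q)) (d - 1), by omega⟩, ?_⟩
    ext i
    simp only [Finset.mem_filter, Finset.mem_univ, true_and, Finset.mem_singleton, Fin.ext_iff]
    unfold pat
    omega

lemma sum_pat_fin (n s m q r A B C : ℕ) (hm : 1 ≤ m) (hs : m * q + r = s) (hn : s ≤ m * n) :
    (q = n ∧ r = 0 ∧ ∑ j : Fin n, (if (j : ℕ) < q then A else if (j : ℕ) = q then B else C) = n * A)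
    ∨ ∃ k, n = q + 1 + k ∧
      ∑ j : Fin n, (if (j : ℕ) < q then A else if (j : ℕ) = q then B else C)
        = q * A + B + k * C := by
  have hq : q ≤ n := by
    by_contra hlt
    have : m * (n + 1) ≤ m * q := Nat.mul_le_mul_left m (by omega)
    rw [mul_add] at this
    omega
  rcases hq.eq_or_lt with rfl | hlt
  · left
    refine ⟨rfl, by omega, ?_⟩
    simp
  · right
    obtain ⟨k, hk⟩ := Nat.exists_eq_add_of_lt hlt
    obtain rfl : n = q + 1 + k := by omega
    refine ⟨k, rfl, ?_⟩
    rw [Fin.sum_univ_eq_sum_range (fun j => if j < q then A else if j = q then B else C)]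
    exact sum_pattern q k A B C

lemma attained (d n α : ℕ) (hd : 2 ≤ d) (hn : 1 ≤ n) (h1 : d ≤ α) (h2 : n ≤ α)
    (h3 : α ≤ d * n) :
    ∃ X : Matrix (Fin d) (Fin n) ℝ,
      IsBinary X ∧ NoZeroRowCol X ∧ nnz X = α ∧ (CD X : ℝ) = Ufun α d n := by
  classical
  rw [Ufun_eq α d n hd h2]
  obtain ⟨s, rfl⟩ := Nat.exists_eq_add_of_le h2
  obtain ⟨m, rfl⟩ : ∃ m, d = m + 1 := ⟨d - 1, by omega⟩
  have e1 : n + s - n = s := by omega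
  have e2 : m + 1 - 1 = m := by omega
  rw [e1, e2]
  have hs := Nat.div_add_mod s m
  have hr : s % m < m := Nat.mod_lt _ (by omega)
  generalize s / m = q at *
  generalize s % m = r at *
  have hsn : s ≤ m * n := by rw [add_mul] at h3; omega
  refine ⟨maxX (m + 1) n q r, ?_, ⟨?_, ?_⟩, ?_, ?_⟩
  · intro i j
    unfold maxX
    split_ifs <;> simp
  · intro i
    simp only [maxX_ne, pat]
    have hi := i.2
    rcases Nat.eq_zero_or_pos q with rfl | hq
    · by_cases hir : (i : ℕ) ≤ r
      · exact ⟨⟨0, hn⟩, Or.inr (Or.inl ⟨rfl, hir⟩)⟩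
      · refine ⟨⟨i - r, by omega⟩, Or.inr (Or.inr ⟨?_, ?_⟩)⟩
        · show 0 < (i : ℕ) - r
          omega
        · show (i : ℕ) = min (r + ((i : ℕ) - r - 0)) (m + 1 - 1)
          omega
    · exact ⟨⟨0, hn⟩, Or.inl hq⟩
  · intro j
    have hc := maxX_col (d := m + 1) (n := n) (q := q) (r := r) (by omega) j
    have : 0 < nnzCol (maxX (m + 1) n q r) j := by
      rw [hc]; split_ifs <;> omega
    obtain ⟨i, hi⟩ := Finset.card_pos.mp this
    exact ⟨i, (Finset.mem_filter.mp hi).2⟩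
  · rw [nnz_eq_col]
    simp only [maxX_col (show r < m + 1 by omega)]
    rcases sum_pat_fin n s m q r (m + 1) (r + 1) 1 (by omega) hs hsn with ⟨rfl, rfl, h⟩ | ⟨k, rfl, h⟩
    · rw [h, ← hs]; ring
    · rw [h, ← hs]; ring
  · norm_cast
    unfold CD
    simp only [maxX_col (show r < m + 1 by omega), ite_pow]
    rcases sum_pat_fin n s m q r ((m + 1) ^ 2) ((r + 1) ^ 2) (1 ^ 2) (by omega) hs hsn with
      ⟨rfl, rfl, h⟩ | ⟨k, rfl, h⟩
    · rw [h, ← hs]; ring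
    · rw [h, ← hs]; ring

/-- `U(α, d, n)` is the maximum of `C_D` over binary `d×n` matrices with no zero
row or column and exactly `α` nonzero entries. -/
theorem CD_max_eq_U
    (d n α : ℕ) (hd : 2 ≤ d) (hn : 1 ≤ n)
    (hα₁ : max d n ≤ α) (hα₂ : α ≤ d * n) :
    (∀ X : Matrix (Fin d) (Fin n) ℝ,
      IsBinary X → NoZeroRowCol X → nnz X = α → (CD X : ℝ) ≤ Ufun α d n) ∧
    (∃ X : Matrix (Fin d) (Fin n) ℝ,
      IsBinary X ∧ NoZeroRowCol X ∧ nnz X = α ∧ (CD X : ℝ) = Ufun α d n) := by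
  exact ⟨fun X _ h hX => upper d n α hd (le_trans (le_max_right _ _) hα₁) X h hX,
    attained d n α hd hn (le_trans (le_max_left _ _) hα₁) (le_trans (le_max_right _ _) hα₁) hα₂⟩
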